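/- Let F be an exponential field with standard kernel ker(exp) = ℤτ (τ transcendental over ℚ) satisfying the Schanuel Property, and let a ∈ F satisfy exp(exp(a)) = 2. Then the ℚ-linear span H := Span_ℚ{a, exp(a), τ} is a strong ℚ-subspace of F, and every strong ℚ-subspace of F containing a contains H; that is, H is the strong hull of {a} in F. -/

import Mathlib

noncomputable section

/-- The subfield of `F` generated by `L ∪ exp(L)`. -/
def expField {F : Type*} [Field F] (exp : F → F) (L : Set F) : Subfield F :=
  Subfield.closure (L ∪ exp '' L)

/-- `L` is a *strong* ℚ-subspace of the exponential field `(F, exp)`: the kernel of `exp`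
is contained in `L`, and the relative predimension `δ(L'/L) ≥ 0` for every
finite-dimensional ℚ-subspace `L'` of `F`.  Concretely, for every finite tuple `a` which
is ℚ-linearly independent over `L` (i.e. a basis of some `L ⊔ L'` over `L`), the
transcendence degree over `K₁ = ℚ(L, exp L)` of `K₂ = ℚ(L₂, exp L₂)`, where
`L₂ = L ⊔ span(a)`, is at least the length of `a`; this is witnessed by a tuple of
elements of `K₂` which is algebraically independent over `K₁`. -/
def IsStrong {F : Type*} [Field F] [CharZero F] (exp : F → F) (L : Submodule ℚ F) : Prop :=
  {x : F | exp x = 1} ⊆ (L : Set F) ∧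
  ∀ (n : ℕ) (a : Fin n → F),
    LinearIndependent ℚ (fun i => (Submodule.Quotient.mk (a i) : F ⧸ L)) →
    ∃ t : Fin n → F,
      (∀ i, t i ∈ expField exp ((L ⊔ Submodule.span ℚ (Set.range a) : Submodule ℚ F) : Set F)) ∧
      AlgebraicIndependent (expField exp (L : Set F)) t

/-- The Schanuel Property for an exponential field `(F, exp)`: for all `z₁, …, zₙ ∈ F`,
`trdeg_ℚ(z₁, …, zₙ, exp z₁, …, exp zₙ) ≥ dim_ℚ Span_ℚ(z₁, …, zₙ)`; the transcendence
degree lower bound is witnessed by a tuple of that length, with entries in the subfield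
generated by the `zᵢ` and `exp zᵢ`, which is algebraically independent over `ℚ`. -/
def SchanuelProperty {F : Type*} [Field F] [CharZero F] (exp : F → F) : Prop :=
  ∀ (n : ℕ) (z : Fin n → F),
    ∃ t : Fin (Module.finrank ℚ (Submodule.span ℚ (Set.range z))) → F,
      (∀ i, t i ∈ Subfield.closure (Set.range z ∪ Set.range (exp ∘ z))) ∧
      AlgebraicIndependent ℚ t

open Cardinal in
/-- A transcendental extension of transcendence degree at least `n` contains `n` algebraically
independent elements. -/
theorem exists_fin_algebraicIndependent {K A : Type*} [Field K] [CommRing A] [IsDomain A]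
    [Algebra K A] {n : ℕ} (h : (n : Cardinal) ≤ Algebra.trdeg K A) :
    ∃ t : Fin n → A, AlgebraicIndependent K t := by
  obtain ⟨s, hs⟩ := exists_isTranscendenceBasis K A
  rw [← hs.cardinalMk_eq_trdeg, ← lift_le.{0}, lift_natCast, ← lift_mk_fin, lift_mk_le'] at h
  obtain ⟨f⟩ := h
  exact ⟨_, hs.1.comp f f.injective⟩

/-- The elements of `F` algebraic over the domain `R`, as a subfield of `F`. -/
def algebraicSubfield (R F : Type*) [CommRing R] [IsDomain R] [Field F] [Algebra R F] :
    Subfield F where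
  __ := (Subalgebra.algebraicClosure R F).toSubring
  inv_mem' _ hx := IsAlgebraic.inv hx

theorem mem_algebraicSubfield {R F : Type*} [CommRing R] [IsDomain R] [Field F] [Algebra R F]
    {x : F} : x ∈ algebraicSubfield R F ↔ IsAlgebraic R x := Iff.rfl

/-- A subfield of `F` algebraic over `k(s)` has transcendence degree over `k` at most the
cardinality of `s`. -/
theorem trdeg_le_of_le_algebraicSubfield {F : Type*} [Field F] [CharZero F] {d : ℕ}
    (v : Fin d → F) (K : Subfield F)
    (hK : K ≤ algebraicSubfield (Algebra.adjoin ℚ (Set.range v)) F) :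
    Algebra.trdeg ℚ K ≤ d := by
  obtain ⟨s, hs⟩ := exists_isTranscendenceBasis ℚ K
  rw [← hs.cardinalMk_eq_trdeg]
  have hind : AlgebraicIndependent ℚ (fun x : s => ((x : K) : F)) :=
    hs.1.map' (f := (algebraMap K F).toRatAlgHom) (algebraMap K F).injective
  have hle := ((AlgebraicIndependent.matroid_indep_iff.2
    hind.to_subtype_range).encard_le_eRk_of_subset
      (X := (AlgebraicIndependent.matroid ℚ F).closure (Set.range v)) (by
        rw [AlgebraicIndependent.matroid_closure_eq]
        rintro _ ⟨x, rfl⟩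
        exact hK x.1.2)).trans
    ((Matroid.eRk_closure_eq _ _).le.trans (Matroid.eRk_le_encard _ _))
  have hv : (Set.range v).encard ≤ d := by
    rw [← Set.image_univ]
    exact (Set.encard_image_le _ _).trans (by simp)
  have hcard := hind.injective.encard_range.trans (hle.trans hv)
  have hfin : Finite s := by
    rw [← ENat.card_lt_top]
    exact lt_of_le_of_lt hcard (by simp)
  rw [← Nat.cast_card, Nat.cast_le]
  rwa [ENat.card_eq_coe_natCard, Nat.cast_le] at hcard

/-- If `K₁ ≤ K₂` are fields with `K₁` of transcendence degree at most `d`, and `K₂` contains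
`n + d` algebraically independent elements, then it contains `n` elements algebraically
independent over `K₁`. -/
theorem exists_algebraicIndependent_of_trdeg_le {F : Type*} [Field F] [CharZero F]
    {K₁ K₂ : Subfield F} (h : K₁ ≤ K₂) {n d m : ℕ} (hd : Algebra.trdeg ℚ K₁ ≤ d)
    (hm : n + d ≤ m) (s : Fin m → F) (hs : ∀ i, s i ∈ K₂) (hind : AlgebraicIndependent ℚ s) :
    ∃ t : Fin n → F, (∀ i, t i ∈ K₂) ∧ AlgebraicIndependent K₁ t := by
  let E : IntermediateField K₁ F := Subfield.extendScalars h
  have hsE : AlgebraicIndependent ℚ (fun i => (⟨s i, hs i⟩ : E)) :=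
    AlgebraicIndependent.of_comp (algebraMap E F).toRatAlgHom hind
  have hE : (m : Cardinal) ≤ Algebra.trdeg ℚ E := by
    have := hsE.lift_cardinalMk_le_trdeg
    simpa using this
  have : FaithfulSMul K₁ E :=
    (faithfulSMul_iff_algebraMap_injective K₁ E).2 (algebraMap K₁ E).injective
  rw [← trdeg_add_eq ℚ K₁] at hE
  have hn : (n : Cardinal) ≤ Algebra.trdeg K₁ E := by
    have h1 : (d : Cardinal) + n ≤ d + Algebra.trdeg K₁ E := by
      calc (d : Cardinal) + n = ((n + d : ℕ) : Cardinal) := by push_cast; ring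
        _ ≤ m := by exact_mod_cast hm
        _ ≤ _ := hE.trans (by gcongr)
    rwa [add_comm, add_comm (d : Cardinal),
      Cardinal.add_le_add_iff_of_lt_aleph0 (Cardinal.natCast_lt_aleph0)] at h1
  obtain ⟨t, ht⟩ := exists_fin_algebraicIndependent hn
  exact ⟨fun i => t i, fun i => (t i).2, ht.map' (f := E.val) E.val.injective⟩

/-- If a subfield `S` of an exponential field is closed under roots and contains `v` and `exp v`,
then it contains `exp` of the `ℚ`-span of `v`. -/
theorem exp_mem_of_mem_span {F : Type*} [Field F] [CharZero F] {exp : F → F}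
    (hexp0 : exp 0 = 1) (hexpadd : ∀ x y : F, exp (x + y) = exp x * exp y)
    {S : Subfield F} (hroot : ∀ (y : F) (n : ℕ), 0 < n → y ^ n ∈ S → y ∈ S)
    {v : Set F} (hexpv : ∀ x ∈ v, exp x ∈ S) {x : F} (hx : x ∈ Submodule.span ℚ v) :
    exp x ∈ S := by
  have hnsmul (n : ℕ) (x : F) : exp (n * x) = exp x ^ n := by
    induction n with
    | zero => simp [hexp0]
    | succ n ih => rw [pow_succ, ← ih, ← hexpadd]; congr 1; push_cast; ring
  have hneg (x : F) : exp (-x) = (exp x)⁻¹ :=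
    eq_inv_of_mul_eq_one_left (by rw [← hexpadd, neg_add_cancel, hexp0])
  have hzsmul (n : ℤ) (x : F) (hx : exp x ∈ S) : exp (n * x) ∈ S := by
    obtain ⟨m, rfl | rfl⟩ := n.eq_nat_or_neg
    · rw [Int.cast_natCast, hnsmul]; exact pow_mem hx _
    · rw [Int.cast_neg, Int.cast_natCast, neg_mul, hneg, hnsmul]; exact inv_mem (pow_mem hx _)
  induction hx using Submodule.span_induction with
  | mem x hx => exact hexpv x hx
  | zero => rw [hexp0]; exact one_mem S
  | add x y _ _ hx hy => rw [hexpadd]; exact mul_mem hx hy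
  | smul q x _ hx =>
    refine hroot _ q.den q.den_pos ?_
    rw [← hnsmul, Rat.smul_def, ← mul_assoc]
    have : (q.den : F) * (q : F) = (q.num : F) := by
      exact_mod_cast congrArg (Rat.cast (K := F)) q.den_mul_eq_num
    rw [this]
    exact hzsmul _ _ hx

theorem mem_of_mem_span {F : Type*} [Field F] [CharZero F] {S : Subfield F}
    {v : Set F} (hv : v ⊆ S) {x : F} (hx : x ∈ Submodule.span ℚ v) : x ∈ S := by
  induction hx using Submodule.span_induction with
  | mem x hx => exact hv hx
  | zero => exact zero_mem S
  | add x y _ _ hx hy => exact add_mem hx hy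
  | smul q x _ hx => rw [Rat.smul_def]; exact mul_mem (SubfieldClass.ratCast_mem S q) hx

/-- If a subfield `S` of an exponential field is closed under roots and contains `v` and `exp v`,
then it contains the field generated by the `ℚ`-span of `v` and its exponentials. -/
theorem expField_span_le {F : Type*} [Field F] [CharZero F] {exp : F → F}
    (hexp0 : exp 0 = 1) (hexpadd : ∀ x y : F, exp (x + y) = exp x * exp y)
    {S : Subfield F} (hroot : ∀ (y : F) (n : ℕ), 0 < n → y ^ n ∈ S → y ∈ S)
    {v : Set F} (hv : v ⊆ S) (hexpv : ∀ x ∈ v, exp x ∈ S) :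
    expField exp (Submodule.span ℚ v : Set F) ≤ S := by
  refine Subfield.closure_le.2 (Set.union_subset (fun x hx => mem_of_mem_span hv hx) ?_)
  rintro _ ⟨x, hx, rfl⟩
  exact exp_mem_of_mem_span hexp0 hexpadd hroot hexpv hx

theorem subset_expField {F : Type*} [Field F] (exp : F → F) (L : Set F) : L ⊆ expField exp L :=
  fun _ hx => Subfield.subset_closure (Or.inl hx)

theorem exp_mem_expField {F : Type*} [Field F] (exp : F → F) {L : Set F} {x : F} (hx : x ∈ L) :
    exp x ∈ expField exp L :=
  Subfield.subset_closure (Or.inr ⟨x, hx, rfl⟩)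

theorem expField_mono {F : Type*} [Field F] (exp : F → F) {L L' : Set F} (h : L ⊆ L') :
    expField exp L ≤ expField exp L' :=
  Subfield.closure_mono (Set.union_subset_union h (Set.image_mono h))

/-- **The strong hull of `a = log log 2`.** Let `F` be an exponential field with standard
kernel `ℤτ` (`τ` transcendental over `ℚ`) satisfying the Schanuel Property, and let
`a ∈ F` satisfy `exp (exp a) = 2`. Then `H = Span_ℚ{a, exp a, τ}` is a strong ℚ-subspace
of `F` and every strong ℚ-subspace containing `a` contains `H`; that is, `H` is the strong
hull of `{a}` in `F`. -/
theorem hull_of_loglog_two {F : Type*} [Field F] [CharZero F] (exp : F → F)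
    (hexp0 : exp 0 = 1) (hexpadd : ∀ x y : F, exp (x + y) = exp x * exp y)
    (τ : F) (hτ : Transcendental ℚ τ)
    (hker : {x : F | exp x = 1} = {x : F | ∃ k : ℤ, x = k • τ})
    (hSP : SchanuelProperty exp)
    (a : F) (ha : exp (exp a) = 2) :
    IsStrong exp (Submodule.span ℚ {a, exp a, τ}) ∧
    ∀ L : Submodule ℚ F, IsStrong exp L → a ∈ L → Submodule.span ℚ {a, exp a, τ} ≤ L := by
  have hτ1 : exp τ = 1 := by
    have : τ ∈ {x : F | exp x = 1} := hker ▸ ⟨1, (one_smul ℤ τ).symm⟩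
    exact this
  set H := Submodule.span ℚ {a, exp a, τ}
  have haH : a ∈ H := Submodule.subset_span (by simp)
  have hbH : exp a ∈ H := Submodule.subset_span (by simp)
  have hτH : τ ∈ H := Submodule.subset_span (by simp)
  refine ⟨⟨?_, fun n z hz => ?_⟩, fun L hL haL => ?_⟩
  · rw [hker]
    rintro _ ⟨k, rfl⟩
    exact zsmul_mem hτH k
  · have : FiniteDimensional ℚ H := FiniteDimensional.span_of_finite ℚ (Set.toFinite _)
    let B := Module.finBasis ℚ H
    let v : Fin (Module.finrank ℚ H) → F := fun i => B i
    have hv : Submodule.span ℚ (Set.range v) = H := by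
      have := congrArg (Submodule.map H.subtype) B.span_eq
      rw [Submodule.map_span, ← Set.range_comp, Submodule.map_top, Submodule.range_subtype] at this
      exact this
    have hHS : (H : Set F) ⊆ algebraicSubfield (Algebra.adjoin ℚ (Set.range v)) F := by
      intro x hx
      rw [← hv] at hx
      refine mem_of_mem_span (fun y hy => ?_) hx
      exact isAlgebraic_algebraMap (⟨y, Algebra.subset_adjoin hy⟩ : Algebra.adjoin ℚ (Set.range v))
    have hK : Algebra.trdeg ℚ (expField exp (H : Set F)) ≤ (Module.finrank ℚ H : ℕ) := by
      refine trdeg_le_of_le_algebraicSubfield v _ ?_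
      refine expField_span_le hexp0 hexpadd (fun y n hn hy => IsAlgebraic.of_pow hn hy)
        (Submodule.subset_span.trans hHS) ?_
      rintro x (rfl | rfl | rfl)
      · exact hHS hbH
      · rw [ha]; exact ofNat_mem _ 2
      · rw [hτ1]; exact one_mem _
    let w : Fin (n + 3) → F := Fin.append z ![a, exp a, τ]
    have hwr : Set.range w = Set.range z ∪ {a, exp a, τ} := by
      have h3 : Set.range ![a, exp a, τ] = {a, exp a, τ} := by
        simp only [Matrix.range_cons, Matrix.range_empty, Set.union_empty, Set.singleton_union]
      rw [← h3, ← Set.Sum.elim_range, ← finSumFinEquiv.surjective.range_comp w]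
      congr 1
      ext (i | i) <;> simp [w]
    have hspan : Submodule.span ℚ (Set.range w) = H ⊔ Submodule.span ℚ (Set.range z) := by
      rw [hwr, Submodule.span_union, sup_comm]
    obtain ⟨s, hs, hind⟩ := hSP _ w
    refine exists_algebraicIndependent_of_trdeg_le
      (expField_mono exp (SetLike.coe_subset_coe.2 le_sup_left)) hK ?_ s (fun i => ?_) hind
    · have hli := B.linearIndependent.sumElim_of_quotient z hz
      have hc := finrank_span_eq_card hli
      have : Submodule.span ℚ (Set.range (Sum.elim (fun i => (B i : F)) z))
          = Submodule.span ℚ (Set.range w) := by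
        rw [hspan, Set.Sum.elim_range, Submodule.span_union]
        exact congrArg (· ⊔ _) hv
      rw [this] at hc
      rw [hc]
      simp [add_comm]
    · refine (Subfield.closure_le.2 ?_ : _ ≤ expField exp _) (hs i)
      rw [← hspan]
      refine Set.union_subset (Submodule.subset_span.trans (subset_expField exp _)) ?_
      rintro _ ⟨j, rfl⟩
      exact exp_mem_expField exp (Submodule.subset_span ⟨j, rfl⟩)
  · have hτL : τ ∈ L := hL.1 hτ1
    have hbL : exp a ∈ L := by
      by_contra hb
      have hli : LinearIndependent ℚ
          (fun i => (Submodule.Quotient.mk ((![exp a] : Fin 1 → F) i) : F ⧸ L)) := by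
        refine LinearIndependent.of_subsingleton 0 ?_
        simpa [Submodule.Quotient.mk_eq_zero] using hb
      obtain ⟨t, ht, hind⟩ := hL.2 1 _ hli
      refine hind.transcendental 0 ?_
      have hLS : ∀ x ∈ expField exp (L : Set F),
          x ∈ algebraicSubfield (expField exp (L : Set F)) F := fun x hx =>
        isAlgebraic_algebraMap (⟨x, hx⟩ : expField exp (L : Set F))
      have hsp : L ⊔ Submodule.span ℚ (Set.range (![exp a] : Fin 1 → F))
          = Submodule.span ℚ (L ∪ {exp a}) := by
        rw [Submodule.span_union, Submodule.span_eq]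
        simp
      have ht0 := ht 0
      rw [hsp] at ht0
      refine expField_span_le (S := algebraicSubfield (expField exp (L : Set F)) F) hexp0 hexpadd
        (fun y n hn hy => IsAlgebraic.of_pow hn hy) ?_ ?_ ht0
      · rintro x (hx | rfl)
        · exact hLS _ (subset_expField exp _ hx)
        · exact hLS _ (exp_mem_expField exp haL)
      · rintro x (hx | rfl)
        · exact hLS _ (exp_mem_expField exp hx)
        · rw [ha]; exact ofNat_mem _ 2
    refine Submodule.span_le.2 ?_
    rintro x (rfl | rfl | rfl)
    exacts [haL, hbL, hτL]
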